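/- arXiv:math/0509437 — 3 statements merged into one kernel-verified Lean document; each statement's English description precedes it below -/
import Mathlib

section
/- Let f ∈ M be nonzero with f ≤_M f0, and let E be a complemented interval in N_f with E ≠ {0}. Then the pointwise supremum h of E, defined by h(t) = sup{g(t) : g ∈ E} for t ∈ U_f, is a nonzero element of L_f and has property (C). -/
open Topology Set Pointwise

/-- A countable subgroup of `C(X, ℝ)` with properties (i)-(iv) from the paper. -/
structure GoodGroup (X : Type*) [TopologicalSpace X] (t0 : X) where
  G : AddSubgroup C(X, ℝ)
  countable : (G : Set C(X, ℝ)).Countable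
  sup_mem : ∀ f g : C(X, ℝ), f ∈ G → g ∈ G → f ⊔ g ∈ G
  inf_mem : ∀ f g : C(X, ℝ), f ∈ G → g ∈ G → f ⊓ g ∈ G
  rat_smul_mem : ∀ (q : ℚ) (f : C(X, ℝ)), f ∈ G → (q : ℝ) • f ∈ G
  f0 : C(X, ℝ)
  f0_mem : f0 ∈ G
  f0_nonneg : ∀ t, 0 ≤ f0 t
  f0_le_one : ∀ t, f0 t ≤ 1
  f0_zero : f0 t0 = 0
  f0_pos : ∀ t, t ≠ t0 → 0 < f0 t
  loc_affine : ∀ f ∈ G, ∃ V : Set X, IsOpen V ∧ t0 ∈ V ∧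
      ∃ lam mu : ℚ, ∀ t ∈ V, f t = (lam : ℝ) + (mu : ℝ) * f0 t
  urysohn : ∀ K V : Set X, IsClosed K → IsOpen V → K ⊆ V → ∀ ρ : ℚ, 0 ≤ ρ →
      ∃ U : Set X, IsOpen U ∧ K ⊆ U ∧ U ⊆ V ∧ ∃ r ∈ G,
        (∀ t, 0 ≤ r t ∧ r t ≤ (ρ : ℝ)) ∧ (∀ t ∈ U, r t = (ρ : ℝ)) ∧
        ∀ t, t ∉ V → r t = 0

variable {X : Type*} [TopologicalSpace X] {t0 : X}

/-- The monoid `M`: `0` together with all nonnegative `f ∈ G` which are strictly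
positive on some punctured neighbourhood of `t0`. -/
def Mset (gg : GoodGroup X t0) : Set C(X, ℝ) :=
  {f | f = 0 ∨ (f ∈ gg.G ∧ (∀ t, 0 ≤ f t) ∧
      ∃ V : Set X, IsOpen V ∧ t0 ∈ V ∧ ∀ t ∈ V, t ≠ t0 → 0 < f t)}

/-- The algebraic order on `M`. -/
def leM (gg : GoodGroup X t0) (g h : C(X, ℝ)) : Prop :=
  ∃ z ∈ Mset gg, h = g + z

/-- The strict algebraic order on `M`. -/
def ltM (gg : GoodGroup X t0) (g h : C(X, ℝ)) : Prop :=
  leM gg g h ∧ g ≠ h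

/-- The order-ideal `N_f` generated by `f`. -/
def Nf (gg : GoodGroup X t0) (f : C(X, ℝ)) : Set C(X, ℝ) :=
  {g ∈ Mset gg | ∃ n : ℕ, 1 ≤ n ∧ leM gg g (n • f)}

/-- The canonical interval `D_f`. -/
def Df (gg : GoodGroup X t0) (f : C(X, ℝ)) : Set C(X, ℝ) :=
  {g ∈ Nf gg f | leM gg g 1}

/-- The co-zero set `U_f` of `f`. -/
def Uf (f : C(X, ℝ)) : Set X := {t | f t ≠ 0}

/-- An order-ideal of `M`: a submonoid hereditary w.r.t. the algebraic order. -/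
def IsOrderIdeal (gg : GoodGroup X t0) (O : Set C(X, ℝ)) : Prop :=
  O ⊆ Mset gg ∧ (0 : C(X, ℝ)) ∈ O ∧ (∀ a ∈ O, ∀ b ∈ O, a + b ∈ O) ∧
  ∀ g ∈ Mset gg, ∀ h ∈ O, leM gg g h → g ∈ O

/-- An interval in `N_f`: a nonempty, hereditary, upward directed subset. -/
def IsInterval (gg : GoodGroup X t0) (f : C(X, ℝ)) (E : Set C(X, ℝ)) : Prop :=
  E.Nonempty ∧ E ⊆ Nf gg f ∧
  (∀ g ∈ Nf gg f, ∀ g' ∈ E, leM gg g g' → g ∈ E) ∧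
  ∀ g1 ∈ E, ∀ g2 ∈ E, ∃ g ∈ E, leM gg g1 g ∧ leM gg g2 g

/-- The `n`-fold sum `E + ⋯ + E` of a set of functions. -/
def nFold (n : ℕ) (E : Set C(X, ℝ)) : Set C(X, ℝ) :=
  {x | ∃ y : Fin n → C(X, ℝ), (∀ i, y i ∈ E) ∧ x = ∑ i, y i}

/-- A complemented interval in `N_f` (with respect to `D_f`). -/
def IsCompInterval (gg : GoodGroup X t0) (f : C(X, ℝ)) (E : Set C(X, ℝ)) : Prop :=
  IsInterval gg f E ∧ ∃ F : Set C(X, ℝ), IsInterval gg f F ∧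
    ∃ k : ℕ, 1 ≤ k ∧ E + F = nFold k (Df gg f)

/-- `h` is a nonzero element of `L_f`: a nonnegative bounded continuous function
on `U_f` admitting a nonzero minorant in `N_f`. -/
def MemLfNZ (gg : GoodGroup X t0) (f : C(X, ℝ)) (h : X → ℝ) : Prop :=
  ContinuousOn h (Uf f) ∧ (∃ C : ℝ, ∀ t ∈ Uf f, h t ≤ C) ∧
  (∀ t ∈ Uf f, 0 ≤ h t) ∧
  ∃ z ∈ Nf gg f, z ≠ (0 : C(X, ℝ)) ∧ ∀ t ∈ Uf f, z t ≤ h t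

/-- `h` belongs to `L_f` (either `0` on `U_f`, or has a nonzero minorant in `N_f`). -/
def MemLf (gg : GoodGroup X t0) (f : C(X, ℝ)) (h : X → ℝ) : Prop :=
  ContinuousOn h (Uf f) ∧ (∃ C : ℝ, ∀ t ∈ Uf f, h t ≤ C) ∧
  (∀ t ∈ Uf f, 0 ≤ h t) ∧
  ((∀ t ∈ Uf f, h t = 0) ∨ ∃ z ∈ Nf gg f, z ≠ (0 : C(X, ℝ)) ∧ ∀ t ∈ Uf f, z t ≤ h t)

/-- The interval `I_f(h)` associated with `h ∈ L_f`. -/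
def Iset (gg : GoodGroup X t0) (f : C(X, ℝ)) (h : X → ℝ) : Set C(X, ℝ) :=
  {g | g = 0 ∨ (g ∈ Nf gg f ∧ ∃ z ∈ Nf gg f, ltM gg g z ∧
      (∀ t ∈ Uf f, z t ≤ h t) ∧
      ∃ V : Set X, IsOpen V ∧ t0 ∈ V ∧ ∀ t ∈ (V \ {t0}) ∩ Uf f, z t < h t)}

/-- Property (C) for a nonzero element of `L_f`. -/
def PropC (gg : GoodGroup X t0) (f : C(X, ℝ)) (h : X → ℝ) : Prop :=
  ∀ t ∈ Uf f, t ≠ t0 → ∃ z ∈ Nf gg f,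
    (∀ s ∈ Uf f, z s ≤ h s) ∧
    (∃ W : Set X, IsOpen W ∧ t ∈ W ∧ ∀ s ∈ W ∩ Uf f, z s = h s) ∧
    ∃ V : Set X, IsOpen V ∧ t0 ∈ V ∧ ∀ s ∈ (V \ {t0}) ∩ Uf f, z s < h s

theorem aux_M_nonneg (gg : GoodGroup X t0) {g : C(X, ℝ)} (h : g ∈ Mset gg) (t : X) : 0 ≤ g t := by
  rcases h with h | h
  · simp [h]
  · exact h.2.1 t

theorem aux_M_mem (gg : GoodGroup X t0) {g : C(X, ℝ)} (h : g ∈ Mset gg) : g ∈ gg.G := by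
  rcases h with h | h
  · rw [h]; exact gg.G.zero_mem
  · exact h.1

theorem aux_M_add (gg : GoodGroup X t0) {g h : C(X, ℝ)} (hg : g ∈ Mset gg) (hh : h ∈ Mset gg) :
    g + h ∈ Mset gg := by
  have hh0 := aux_M_nonneg gg hh
  have hhG := aux_M_mem gg hh
  rcases hg with rfl | ⟨h1, h2, V, hV, h3, h4⟩
  · simpa using hh
  · refine Or.inr ⟨gg.G.add_mem h1 hhG, fun t => ?_, V, hV, h3, fun t ht hne => ?_⟩
    · have := h2 t; have := hh0 t; simp only [ContinuousMap.add_apply]; linarith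
    · have := h4 t ht hne; have := hh0 t; simp only [ContinuousMap.add_apply]; linarith

theorem aux_one_mem (gg : GoodGroup X t0) : (1 : C(X, ℝ)) ∈ gg.G := by
  obtain ⟨U, -, hU, -, r, hr, -, h2, -⟩ := gg.urysohn univ univ isClosed_univ isOpen_univ
    subset_rfl 1 zero_le_one
  have : r = 1 := by
    ext t
    simpa using h2 t (hU (mem_univ t))
  rwa [← this]

theorem aux_D_le (gg : GoodGroup X t0) {f : C(X, ℝ)} {k : ℕ} {x : C(X, ℝ)}
    (hx : x ∈ nFold k (Df gg f)) (t : X) : x t ≤ k := by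
  obtain ⟨y, hy, rfl⟩ := hx
  have : ∀ i, y i t ≤ 1 := fun i => by
    obtain ⟨z, hz, h⟩ := (hy i).2
    have h1 := aux_M_nonneg gg hz t
    have h2 := congrArg (fun q : C(X, ℝ) => q t) h
    simp only [ContinuousMap.one_apply, ContinuousMap.add_apply] at h2
    linarith
  have h3 := Finset.sum_le_sum (s := Finset.univ) (fun i _ => this i)
  simpa using h3

/-- the truncations `min (n f) 1` belong to `D_f`. -/
theorem aux_D_mem (gg : GoodGroup X t0) {f : C(X, ℝ)} (hfM : f ∈ Mset gg) (hf : f ≠ 0)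
    (hf0 : f t0 = 0) (n : ℕ) (hn : 1 ≤ n) : (n • f) ⊓ 1 ∈ Df gg f := by
  rcases hfM with h | ⟨h1, h2, V, hV, h3, h4⟩
  · exact absurd h hf
  have hn' : (1 : ℝ) ≤ n := by exact_mod_cast hn
  have hns : ∀ (m : ℕ) (t : X), (m • f) t = m * f t := fun m t => by
    rw [ContinuousMap.nsmul_apply, nsmul_eq_mul]
  have hG : (n • f) ⊓ 1 ∈ gg.G := gg.inf_mem _ _ (gg.G.nsmul_mem h1 n) (aux_one_mem gg)
  refine ⟨⟨Or.inr ⟨hG, fun t => ?_, V, hV, h3, fun t ht hne => ?_⟩, n + 1, by omega,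
    (n + 1) • f - (n • f) ⊓ 1, Or.inr ⟨gg.G.sub_mem (gg.G.nsmul_mem h1 _) hG, fun t => ?_,
      V, hV, h3, fun t ht hne => ?_⟩, by abel⟩, 1 - (n • f) ⊓ 1,
      Or.inr ⟨gg.G.sub_mem (aux_one_mem gg) hG, fun t => ?_,
        {t | (n • f) t < 1}, isOpen_lt (n • f).continuous continuous_const, by simp [hf0],
        fun t ht hne => ?_⟩, by abel⟩
  · have := h2 t
    simp only [ContinuousMap.inf_apply, hns, ContinuousMap.one_apply]
    exact le_min (by positivity) zero_le_one
  · have := h4 t ht hne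
    simp only [ContinuousMap.inf_apply, hns, ContinuousMap.one_apply]
    exact lt_min (by positivity) zero_lt_one
  · have := h2 t
    have := min_le_left ((n : ℝ) * f t) 1
    simp only [ContinuousMap.inf_apply, hns, ContinuousMap.one_apply, ContinuousMap.sub_apply]
    push_cast
    linarith
  · have := h4 t ht hne
    have := min_le_left ((n : ℝ) * f t) 1
    simp only [ContinuousMap.inf_apply, hns, ContinuousMap.one_apply, ContinuousMap.sub_apply]
    push_cast
    linarith
  · have := min_le_right ((n : ℝ) * f t) 1
    simp only [ContinuousMap.inf_apply, hns, ContinuousMap.one_apply, ContinuousMap.sub_apply]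
    linarith
  · have := min_le_left ((n : ℝ) * f t) 1
    simp only [ContinuousMap.inf_apply, hns, ContinuousMap.one_apply, ContinuousMap.sub_apply, mem_ofPred_eq] at ht ⊢
    linarith

theorem aux_local (gg : GoodGroup X t0) {f : C(X, ℝ)} (hfM : f ∈ Mset gg) (hf : f ≠ 0)
    (hf0 : f t0 = 0) {E : Set C(X, ℝ)} (hE : IsCompInterval gg f E) (hEne : E ≠ {0})
    (t : X) (ht : t ∈ Uf f) :
    ∃ e ∈ E, e ≠ 0 ∧ ∃ W : Set X, IsOpen W ∧ t ∈ W ∧ ∀ s ∈ W, ∀ e' ∈ E, e' s ≤ e s := by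
  obtain ⟨⟨hne, hsub, -, hdir⟩, F, -, k, hk, hsum⟩ := hE
  have hpos : 0 < f t := lt_of_le_of_ne (aux_M_nonneg gg hfM t) (Ne.symm ht)
  obtain ⟨n, hn⟩ := exists_nat_gt (1 / f t)
  have hn1 : 1 < n * f t := by rwa [div_lt_iff₀ hpos] at hn
  have hn0 : 1 ≤ n := by
    rcases Nat.eq_zero_or_pos n with h | h
    · simp [h] at hn1; linarith
    · exact h
  have hmem : (∑ _i : Fin k, (n • f) ⊓ 1) ∈ E + F := by
    rw [hsum]
    exact ⟨fun _ => (n • f) ⊓ 1, fun _ => aux_D_mem gg hfM hf hf0 n hn0, rfl⟩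
  obtain ⟨e, he, φ, hφ, heφ⟩ := hmem
  have key : ∀ s, 1 < (n : ℝ) * f s → ∀ e' ∈ E, e' s ≤ e s := by
    intro s hs e' he'
    have h1 : e' + φ ∈ nFold k (Df gg f) := by rw [← hsum]; exact add_mem_add he' hφ
    have h2 := aux_D_le gg h1 s
    have h3 := congrArg (fun q : C(X, ℝ) => q s) heφ
    simp [min_eq_right hs.le] at h2 h3
    linarith
  obtain ⟨a, ha, ha0⟩ : ∃ a ∈ E, a ≠ 0 := by
    by_contra! hcon
    apply hEne
    obtain ⟨b, hb⟩ := hne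
    ext x
    constructor
    · intro hx; exact hcon x hx
    · rintro rfl; rw [← hcon b hb]; exact hb
  obtain ⟨c, hc, ⟨z, hz, hcz⟩, ⟨w, hw, hcw⟩⟩ := hdir e he a ha
  refine ⟨c, hc, ?_, {s | 1 < (n : ℝ) * f s}, isOpen_lt continuous_const (by fun_prop), hn1, ?_⟩
  · rintro rfl
    apply ha0
    ext s
    have h1 := congrArg (fun q : C(X, ℝ) => q s) hcw
    have h2 := aux_M_nonneg gg hw s
    have h3 := aux_M_nonneg gg (hsub ha).1 s
    simp at h1 ⊢
    linarith
  · intro s hs e' he'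
    have h1 := key s hs e' he'
    have h2 := aux_M_nonneg gg hz s
    rw [hcz]
    simp only [ContinuousMap.add_apply]
    linarith

variable [CompactSpace X] [TopologicalSpace.MetrizableSpace X] [Infinite X]

/-- the pointwise supremum of a nonzero complemented interval is a
nonzero element of `L_f` with property (C). -/
theorem statement_11 (ht0 : Filter.NeBot (𝓝[≠] t0)) (gg : GoodGroup X t0)
    (f : C(X, ℝ)) (hfM : f ∈ Mset gg) (hf : f ≠ 0) (hff0 : leM gg f gg.f0)
    (E : Set C(X, ℝ)) (hE : IsCompInterval gg f E) (hEne : E ≠ {0}) :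
    MemLfNZ gg f (fun t => sSup {r : ℝ | ∃ g ∈ E, g t = r}) ∧
    PropC gg f (fun t => sSup {r : ℝ | ∃ g ∈ E, g t = r}) := by
  have hf0 : f t0 = 0 := by
    obtain ⟨z, hz, h⟩ := hff0
    have h1 := aux_M_nonneg gg hz t0
    have h2 := aux_M_nonneg gg hfM t0
    have h3 := congrArg (fun q : C(X, ℝ) => q t0) h
    simp only [ContinuousMap.add_apply, gg.f0_zero] at h3
    linarith
  have hff0' : ∀ s, f s ≤ gg.f0 s := by
    obtain ⟨z, hz, h⟩ := hff0
    intro s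
    have h1 := aux_M_nonneg gg hz s
    rw [h]
    simp only [ContinuousMap.add_apply]
    linarith
  have hloc := aux_local gg hfM hf hf0 hE hEne
  have hsup : ∀ e ∈ E, ∀ s, (∀ e' ∈ E, e' s ≤ e s) →
      sSup {r : ℝ | ∃ g ∈ E, g s = r} = e s := by
    intro e he s hs
    apply IsGreatest.csSup_eq
    refine ⟨⟨e, he, rfl⟩, ?_⟩
    rintro _ ⟨g, hg, rfl⟩
    exact hs g hg
  obtain ⟨⟨hne, hsub, -, hdir⟩, F, ⟨⟨φ, hφ⟩, hFsub, -⟩, k, hk, hsum⟩ := hE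
  have hbd : ∀ e ∈ E, ∀ s, e s ≤ k := by
    intro e he s
    have h1 : e + φ ∈ nFold k (Df gg f) := by rw [← hsum]; exact add_mem_add he hφ
    have h2 := aux_D_le gg h1 s
    have h3 := aux_M_nonneg gg (hFsub hφ).1 s
    simp only [ContinuousMap.add_apply] at h2
    linarith
  have hle : ∀ e ∈ E, ∀ s, e s ≤ sSup {r : ℝ | ∃ g ∈ E, g s = r} := by
    intro e he s
    refine le_csSup ⟨k, ?_⟩ ⟨e, he, rfl⟩
    rintro _ ⟨g, hg, rfl⟩
    exact hbd g hg s
  have hUne : ∃ t, t ∈ Uf f := by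
    by_contra! hcon
    apply hf
    ext t
    by_contra h
    exact hcon t h
  refine ⟨⟨?_, ⟨k, ?_⟩, ?_, ?_⟩, ?_⟩
  · intro t ht
    obtain ⟨e, he, -, W, hW, htW, hmax⟩ := hloc t ht
    apply ContinuousAt.continuousWithinAt
    refine (e.continuous.continuousAt (x := t)).congr ?_
    filter_upwards [hW.mem_nhds htW] with s hs
    exact (hsup e he s (hmax s hs)).symm
  · intro t ht
    obtain ⟨e, he, -, W, hW, htW, hmax⟩ := hloc t ht
    simp only [hsup e he t (hmax t htW)]
    exact hbd e he t
  · intro t ht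
    obtain ⟨e, he⟩ := hne
    exact (aux_M_nonneg gg (hsub he).1 t).trans (hle e he t)
  · obtain ⟨t, ht⟩ := hUne
    obtain ⟨e, he, he0, -⟩ := hloc t ht
    exact ⟨e, hsub he, he0, fun s _ => hle e he s⟩
  · intro t ht htt
    obtain ⟨e, he, he0, W, hW, htW, hmax⟩ := hloc t ht
    obtain ⟨heM, n, hn, y, hy, hny⟩ := hsub he
    have heM' := heM
    rcases heM' with h | ⟨heG, hepos, V, hV, ht0V, hVpos⟩
    · exact absurd h he0
    have hfM' := hfM
    rcases hfM' with h | ⟨hfG, hfpos, Vf, hVf, ht0Vf, hVfpos⟩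
    · exact absurd h hf
    have het0 : e t0 = 0 := by
      have h1 := congrArg (fun q : C(X, ℝ) => q t0) hny
      have h2 := aux_M_nonneg gg hy t0
      have h3 := hepos t0
      simp [hf0] at h1
      linarith
    obtain ⟨A, hA, ht0A, lam, mu, hlm⟩ := gg.loc_affine e heG
    have hlam : (lam : ℝ) = 0 := by
      have := hlm t0 ht0A
      rw [het0, gg.f0_zero] at this
      linarith
    obtain ⟨P, Q, hP, hQ, htP, ht0Q, hPQ⟩ := t2_separation htt
    have hVA : A ∩ V ∈ 𝓝 t0 := (hA.inter hV).mem_nhds ⟨ht0A, ht0V⟩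
    have hmu : 0 < (mu : ℝ) := by
      have h1 : ∀ᶠ s in 𝓝[≠] t0, s ∈ A ∩ V := mem_nhdsWithin_of_mem_nhds hVA
      obtain ⟨s, hs, hst⟩ := (h1.and self_mem_nhdsWithin).exists
      have h2 := hVpos s hs.2 hst
      rw [hlm s hs.1, hlam, zero_add] at h2
      exact pos_of_mul_pos_left h2 (gg.f0_nonneg s)
    obtain ⟨U, hU, htU, -, r, hrG, hr, hrU, hrP⟩ := gg.urysohn {t} P isClosed_singleton hP
      (by simpa using htP) k (by positivity)
    set u : C(X, ℝ) := ((mu / 2 : ℚ) : ℝ) • f with hu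
    have huG : u ∈ gg.G := gg.rat_smul_mem _ _ hfG
    have hus : ∀ s, u s = (mu : ℝ) / 2 * f s := by intro s; simp [hu]
    have hunn : ∀ s, 0 ≤ u s := by intro s; rw [hus]; have := hfpos s; positivity
    set z : C(X, ℝ) := e ⊓ (u ⊔ r) with hzdef
    have hzs : ∀ s, z s = min (e s) (max (u s) (r s)) := fun s => rfl
    have hzG : z ∈ gg.G := gg.inf_mem _ _ heG (gg.sup_mem _ _ huG hrG)
    have hze : ∀ s, z s ≤ e s := fun s => min_le_left _ _
    have hlt : ∀ s ∈ A ∩ V ∩ Q, s ≠ t0 → z s < e s := by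
      intro s hs hst
      have hr0 : r s = 0 := hrP s (fun h => hPQ.le_bot ⟨h, hs.2⟩)
      have h1 : e s = mu * gg.f0 s := by rw [hlm s hs.1.1, hlam, zero_add]
      have h2 := gg.f0_pos s hst
      have h3 := hff0' s
      have h4 : u s < e s := by
        rw [hus, h1]
        nlinarith [mul_pos hmu h2, mul_le_mul_of_nonneg_left h3 hmu.le]
      rw [hzs, hr0, max_eq_left (hunn s), min_eq_right h4.le]
      exact h4
    have hopen : IsOpen (A ∩ V ∩ Q) := (hA.inter hV).inter hQ
    have hezM : e - z ∈ Mset gg := by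
      refine Or.inr ⟨gg.G.sub_mem heG hzG, fun s => ?_, A ∩ V ∩ Q, hopen, ⟨⟨ht0A, ht0V⟩, ht0Q⟩,
        fun s hs hst => ?_⟩
      · have := hze s; simp only [ContinuousMap.sub_apply]; linarith
      · have := hlt s hs hst; simp only [ContinuousMap.sub_apply]; linarith
    refine ⟨z, ⟨Or.inr ⟨hzG, fun s => le_min (hepos s) (le_max_of_le_left (hunn s)), V ∩ Vf,
      hV.inter hVf, ⟨ht0V, ht0Vf⟩, fun s hs hst => ?_⟩, n, hn, (e - z) + y, aux_M_add gg hezM hy,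
      by rw [hny]; abel⟩, fun s _ => (hze s).trans (hle e he s),
      ⟨W ∩ U, hW.inter hU, ⟨htW, htU rfl⟩, fun s hs => ?_⟩,
      A ∩ V ∩ Q, hopen, ⟨⟨ht0A, ht0V⟩, ht0Q⟩, fun s hs => ?_⟩
    · refine lt_min (hVpos s hs.1 hst) (lt_max_of_lt_left ?_)
      rw [hus]
      have := hVfpos s hs.2 hst
      positivity
    · simp only [hsup e he s (hmax s hs.1.1)]
      rw [hzs, hrU s hs.1.2]
      apply min_eq_left
      apply le_max_of_le_right
      have := hbd e he s
      simpa using this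
    · exact (hlt s hs.1.1 hs.1.2).trans_le (hle e he s)
end

section
/- Let f ∈ M be nonzero with f ≤_M f0, let n ≥ 1 be an integer, and let h ∈ L_f be nonzero such that h has property (C), the function n − h (defined by t ↦ n − h(t) on U_f) is a nonzero element of L_f having property (C), and there exists ε > 0 with n − h(t) ≥ ε for all t ∈ U_f. Then I_f(h) + I_f(n − h) = n·D_f. In particular, I_f(h) is a complemented interval in N_f. -/
open Topology Set Pointwise

variable {X : Type*} [TopologicalSpace X] {t0 : X}

lemma ev_iff (P : X → Prop) : (∃ V : Set X, IsOpen V ∧ t0 ∈ V ∧ ∀ t ∈ V, t ≠ t0 → P t) ↔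
    ∀ᶠ t in 𝓝[≠] t0, P t := by
  rw [eventually_nhdsWithin_iff, eventually_nhds_iff]
  constructor
  · rintro ⟨V, a, b, c⟩
    exact ⟨V, c, a, b⟩
  · rintro ⟨V, c, a, b⟩
    exact ⟨V, a, b, c⟩

lemma ev_iff2 (U : Set X) (P : X → Prop) :
    (∃ V : Set X, IsOpen V ∧ t0 ∈ V ∧ ∀ t ∈ (V \ {t0}) ∩ U, P t) ↔
    ∀ᶠ t in 𝓝[≠] t0, t ∈ U → P t := by
  rw [← ev_iff]
  constructor
  · rintro ⟨V, a, b, c⟩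
    exact ⟨V, a, b, fun t h1 h2 h3 => c t ⟨⟨h1, h2⟩, h3⟩⟩
  · rintro ⟨V, a, b, c⟩
    exact ⟨V, a, b, fun t h1 => c t h1.1.1 h1.1.2 h1.2⟩

/-- nonzero elements of M -/
def PosM (gg : GoodGroup X t0) (g : C(X, ℝ)) : Prop :=
  g ∈ gg.G ∧ (∀ t, 0 ≤ g t) ∧ ∀ᶠ t in 𝓝[≠] t0, 0 < g t

lemma mem_M (gg : GoodGroup X t0) (g : C(X, ℝ)) : g ∈ Mset gg ↔ g = 0 ∨ PosM gg g := by
  unfold PosM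
  rw [← ev_iff]
  rfl

lemma PosM.ne (ht0 : Filter.NeBot (𝓝[≠] t0)) {gg : GoodGroup X t0} {g : C(X, ℝ)}
    (h : PosM gg g) : g ≠ 0 := by
  rintro rfl
  obtain ⟨t, ht⟩ := h.2.2.exists
  simp at ht

lemma M_G {gg : GoodGroup X t0} {g : C(X, ℝ)} (h : g ∈ Mset gg) : g ∈ gg.G := by
  rcases (mem_M gg g).1 h with rfl | h
  · exact gg.G.zero_mem
  · exact h.1

lemma M_nn {gg : GoodGroup X t0} {g : C(X, ℝ)} (h : g ∈ Mset gg) (t : X) : 0 ≤ g t := by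
  rcases (mem_M gg g).1 h with rfl | h
  · simp
  · exact h.2.1 t

lemma le_of_leM {gg : GoodGroup X t0} {g h : C(X, ℝ)} (H : leM gg g h) (t : X) : g t ≤ h t := by
  obtain ⟨z, hz, rfl⟩ := H
  have := M_nn hz t
  simp [this]

lemma leM_of_pos {gg : GoodGroup X t0} {g h : C(X, ℝ)} (H : PosM gg (h - g)) : leM gg g h :=
  ⟨h - g, (mem_M _ _).2 (Or.inr H), by abel⟩

lemma ltM_iff (ht0 : Filter.NeBot (𝓝[≠] t0)) {gg : GoodGroup X t0} {g h : C(X, ℝ)} :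
    ltM gg g h ↔ PosM gg (h - g) := by
  constructor
  · rintro ⟨⟨z, hz, rfl⟩, hne⟩
    rcases (mem_M gg z).1 hz with rfl | hz
    · simp at hne
    · simpa using hz
  · intro H
    refine ⟨leM_of_pos H, ?_⟩
    rintro rfl
    exact H.ne ht0 (sub_self _)

lemma half_mem (gg : GoodGroup X t0) {g : C(X, ℝ)} (h : g ∈ gg.G) : (1/2 : ℝ) • g ∈ gg.G := by
  have := gg.rat_smul_mem (1/2) g h
  push_cast at this
  exact this

lemma const_mem (gg : GoodGroup X t0) (q : ℚ) (hq : 0 ≤ q) :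
    ContinuousMap.const X (q : ℝ) ∈ gg.G := by
  obtain ⟨U, -, h1, -, r, hr, -, h2, -⟩ := gg.urysohn univ univ isClosed_univ isOpen_univ
    (subset_refl _) q hq
  convert hr
  ext t
  simp [h2 t (h1 (mem_univ t))]

lemma mem_Nf {gg : GoodGroup X t0} {f : C(X, ℝ)} (hf : PosM gg f) (g : C(X, ℝ)) :
    g ∈ Nf gg f ↔ g ∈ Mset gg ∧ ∃ C : ℝ, ∀ t, g t ≤ C * f t := by
  constructor
  · rintro ⟨h1, n, hn, h2⟩
    refine ⟨h1, n, fun t => ?_⟩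
    have := le_of_leM h2 t
    simpa using this
  · rintro ⟨h1, C, h2⟩
    obtain ⟨n, hn⟩ := exists_nat_gt C
    have key : ∀ t, f t ≤ ((n+1) • f - g) t := by
      intro t
      have := h2 t
      have h3 := hf.2.1 t
      simp
      nlinarith
    refine ⟨h1, n+1, by omega, leM_of_pos ⟨gg.G.sub_mem (gg.G.nsmul_mem hf.1 _) (M_G h1),
      fun t => (hf.2.1 t).trans (key t), ?_⟩⟩
    filter_upwards [hf.2.2] with t ht
    exact ht.trans_le (key t)

lemma Nf_of_le {gg : GoodGroup X t0} {f g g' : C(X, ℝ)} (hf : PosM gg f) (hg : g ∈ Nf gg f)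
    (h : PosM gg g') (hle : ∀ t, g' t ≤ g t) : g' ∈ Nf gg f := by
  obtain ⟨-, C, hC⟩ := (mem_Nf hf g).1 hg
  exact (mem_Nf hf g').2 ⟨(mem_M _ _).2 (Or.inr h), C, fun t => (hle t).trans (hC t)⟩

lemma Nf_zero {gg : GoodGroup X t0} {f g : C(X, ℝ)} (hf : PosM gg f) (hg : g ∈ Nf gg f)
    {t : X} (ht : t ∉ Uf f) : g t = 0 := by
  obtain ⟨h1, C, hC⟩ := (mem_Nf hf g).1 hg
  have h2 : f t = 0 := by simpa [Uf] using ht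
  have := hC t
  rw [h2, mul_zero] at this
  exact le_antisymm this (M_nn h1 t)

lemma zero_Nf {gg : GoodGroup X t0} {f : C(X, ℝ)} (hf : PosM gg f) : 0 ∈ Nf gg f :=
  (mem_Nf hf 0).2 ⟨(mem_M _ _).2 (Or.inl rfl), 0, by simp⟩

lemma M_add {gg : GoodGroup X t0} {a b : C(X, ℝ)} (ha : a ∈ Mset gg) (hb : b ∈ Mset gg) :
    a + b ∈ Mset gg := by
  rcases (mem_M _ _).1 ha with rfl | ha
  · simpa
  refine (mem_M _ _).2 (Or.inr ⟨gg.G.add_mem ha.1 (M_G hb), fun t => ?_, ?_⟩)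
  · have := ha.2.1 t
    have := M_nn hb t
    simp; linarith
  · filter_upwards [ha.2.2] with t ht
    have := M_nn hb t
    simp; linarith

lemma Nf_add {gg : GoodGroup X t0} {f a b : C(X, ℝ)} (hf : PosM gg f) (ha : a ∈ Nf gg f)
    (hb : b ∈ Nf gg f) : a + b ∈ Nf gg f := by
  obtain ⟨h1, C, hC⟩ := (mem_Nf hf a).1 ha
  obtain ⟨h2, D, hD⟩ := (mem_Nf hf b).1 hb
  refine (mem_Nf hf _).2 ⟨M_add h1 h2, C + D, fun t => ?_⟩
  have := hC t
  have := hD t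
  simp; linarith

lemma PosM.sup {gg : GoodGroup X t0} {a b : C(X, ℝ)} (ha : PosM gg a) (hb : b ∈ gg.G) :
    PosM gg (a ⊔ b) := by
  refine ⟨gg.sup_mem _ _ ha.1 hb, fun t => ?_, ?_⟩
  · simp [ha.2.1 t]
  · filter_upwards [ha.2.2] with t ht
    simp [ht]

lemma PosM.inf {gg : GoodGroup X t0} {a b : C(X, ℝ)} (ha : PosM gg a) (hb : PosM gg b) :
    PosM gg (a ⊓ b) := by
  refine ⟨gg.inf_mem _ _ ha.1 hb.1, fun t => ?_, ?_⟩
  · simp [ha.2.1 t, hb.2.1 t]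
  · filter_upwards [ha.2.2, hb.2.2] with t ht ht'
    simp [ht, ht']

lemma Nf_sup {gg : GoodGroup X t0} {f a b : C(X, ℝ)} (hf : PosM gg f) (ha : a ∈ Nf gg f)
    (hb : b ∈ Nf gg f) : a ⊔ b ∈ Nf gg f := by
  have h1 := ha.1
  have h2 := hb.1
  have hab := Nf_add hf ha hb
  have n1 := M_nn h1
  have n2 := M_nn h2
  rcases (mem_M _ _).1 h1 with rfl | h1
  · convert hb
    ext t
    simpa using n2 t
  · refine Nf_of_le hf hab (h1.sup (M_G h2)) fun t => ?_
    have := n1 t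
    have := n2 t
    simp
    constructor <;> linarith

/-- admissible upper bounds in the definition of `I_f(h)` -/
def SS (gg : GoodGroup X t0) (f : C(X, ℝ)) (h : X → ℝ) (z : C(X, ℝ)) : Prop :=
  z ∈ Nf gg f ∧ (∀ t ∈ Uf f, z t ≤ h t) ∧ ∀ᶠ t in 𝓝[≠] t0, t ∈ Uf f → z t < h t

lemma SS.sup {gg : GoodGroup X t0} {f a b : C(X, ℝ)} {h : X → ℝ} (hf : PosM gg f)
    (ha : SS gg f h a) (hb : SS gg f h b) : SS gg f h (a ⊔ b) := by
  refine ⟨Nf_sup hf ha.1 hb.1, fun t ht => ?_, ?_⟩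
  · simp [ha.2.1 t ht, hb.2.1 t ht]
  · filter_upwards [ha.2.2, hb.2.2] with t h1 h2 ht
    simp [h1 ht, h2 ht]

lemma mem_I (ht0 : Filter.NeBot (𝓝[≠] t0)) (gg : GoodGroup X t0) (f : C(X, ℝ)) (h : X → ℝ)
    (g : C(X, ℝ)) :
    g ∈ Iset gg f h ↔ g = 0 ∨ (g ∈ Nf gg f ∧ ∃ z, SS gg f h z ∧ PosM gg (z - g)) := by
  constructor
  · rintro (h | ⟨h1, z, h2, h3, h4, h5⟩)
    · exact Or.inl h
    · exact Or.inr ⟨h1, z, ⟨h2, h4, (ev_iff2 _ _).1 h5⟩, (ltM_iff ht0).1 h3⟩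
  · rintro (h | ⟨h1, z, ⟨h2, h4, h5⟩, h3⟩)
    · exact Or.inl h
    · exact Or.inr ⟨h1, z, h2, (ltM_iff ht0).2 h3, h4, (ev_iff2 _ _).2 h5⟩

lemma I_sub {gg : GoodGroup X t0} {f : C(X, ℝ)} {h : X → ℝ} (hf : PosM gg f) {g : C(X, ℝ)}
    (hg : g ∈ Iset gg f h) : g ∈ Nf gg f := by
  rcases hg with rfl | hg
  · exact zero_Nf hf
  · exact hg.1

lemma I_le (ht0 : Filter.NeBot (𝓝[≠] t0)) {gg : GoodGroup X t0} {f : C(X, ℝ)} {h : X → ℝ}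
    (hnn : ∀ t ∈ Uf f, 0 ≤ h t) {g : C(X, ℝ)}
    (hg : g ∈ Iset gg f h) (t : X) (ht : t ∈ Uf f) : g t ≤ h t := by
  rcases (mem_I ht0 _ _ _ _).1 hg with rfl | ⟨-, z, hz, hp⟩
  · simpa using hnn t ht
  · have := hz.2.1 t ht
    have := hp.2.1 t
    simp at this
    linarith

lemma I_interval (ht0 : Filter.NeBot (𝓝[≠] t0)) {gg : GoodGroup X t0} {f : C(X, ℝ)}
    (hf : PosM gg f) (h : X → ℝ) : IsInterval gg f (Iset gg f h) := by
  refine ⟨⟨0, Or.inl rfl⟩, fun g hg => I_sub hf hg, ?_, ?_⟩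
  · intro g hg g' hg' hle
    have hle' := le_of_leM hle
    rcases (mem_I ht0 _ _ _ _).1 hg' with rfl | ⟨h1, z, hz, hp⟩
    · left
      ext t
      exact le_antisymm (hle' t) (M_nn hg.1 t)
    · refine (mem_I ht0 _ _ _ _).2 (Or.inr ⟨hg, z, hz, gg.G.sub_mem (M_G hz.1.1) (M_G hg.1),
        fun t => ?_, ?_⟩)
      · have := hp.2.1 t
        have := hle' t
        simp at *
        linarith
      · filter_upwards [hp.2.2] with t ht
        have := hle' t
        simp at *
        linarith
  · intro g1 h1 g2 h2
    have n1 := I_sub hf h1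
    have n2 := I_sub hf h2
    rcases (mem_I ht0 _ _ _ _).1 h1 with rfl | ⟨-, z1, hz1, hp1⟩
    · exact ⟨g2, h2, ⟨g2, n2.1, by simp⟩, ⟨0, (mem_M _ _).2 (Or.inl rfl), by simp⟩⟩
    rcases (mem_I ht0 _ _ _ _).1 h2 with rfl | ⟨-, z2, hz2, hp2⟩
    · exact ⟨g1, h1, ⟨0, (mem_M _ _).2 (Or.inl rfl), by simp⟩, ⟨g1, n1.1, by simp⟩⟩
    have hz := hz1.sup hf hz2
    set z := z1 ⊔ z2 with hzdef
    have zG := M_G hz.1.1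
    have e1 : ∀ t, z1 t ≤ z t := fun t => by simp [hzdef]
    have e2 : ∀ t, z2 t ≤ z t := fun t => by simp [hzdef]
    set g := (1/2 : ℝ) • ((g1 ⊔ g2) + z) with hgdef
    have hgt : ∀ t, g t = ((max (g1 t) (g2 t)) + z t) / 2 := fun t => by
      simp [hgdef]; ring
    have gG : g ∈ gg.G := half_mem gg (gg.G.add_mem (gg.sup_mem _ _ (M_G n1.1) (M_G n2.1)) zG)
    have p1 : PosM gg (g - g1) := by
      refine ⟨gg.G.sub_mem gG (M_G n1.1), fun t => ?_, ?_⟩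
      · have a1 := hp1.2.1 t
        have a2 := e1 t
        have a3 := le_max_left (g1 t) (g2 t)
        rw [ContinuousMap.sub_apply] at a1 ⊢
        rw [hgt]
        linarith
      · filter_upwards [hp1.2.2] with t a1
        have a2 := e1 t
        have a3 := le_max_left (g1 t) (g2 t)
        rw [ContinuousMap.sub_apply] at a1 ⊢
        rw [hgt]
        linarith
    have p2 : PosM gg (g - g2) := by
      refine ⟨gg.G.sub_mem gG (M_G n2.1), fun t => ?_, ?_⟩
      · have a1 := hp2.2.1 t
        have a2 := e2 t
        have a3 := le_max_right (g1 t) (g2 t)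
        rw [ContinuousMap.sub_apply] at a1 ⊢
        rw [hgt]
        linarith
      · filter_upwards [hp2.2.2] with t a1
        have a2 := e2 t
        have a3 := le_max_right (g1 t) (g2 t)
        rw [ContinuousMap.sub_apply] at a1 ⊢
        rw [hgt]
        linarith
    have mz : ∀ t, max (g1 t) (g2 t) ≤ z t := fun t => by
      have a1 := hp1.2.1 t
      have a2 := e1 t
      have a3 := hp2.2.1 t
      have a4 := e2 t
      rw [ContinuousMap.sub_apply] at a1 a3
      exact max_le (by linarith) (by linarith)
    refine ⟨g, (mem_I ht0 _ _ _ _).2 (Or.inr ⟨?_, z, hz, gg.G.sub_mem zG gG, ?_, ?_⟩),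
      leM_of_pos p1, leM_of_pos p2⟩
    · refine Nf_of_le hf hz.1 ⟨gG, fun t => ?_, ?_⟩ fun t => ?_
      · have a1 := p1.2.1 t
        have := M_nn n1.1 t
        rw [ContinuousMap.sub_apply] at a1
        linarith
      · filter_upwards [p1.2.2] with t a1
        have := M_nn n1.1 t
        rw [ContinuousMap.sub_apply] at a1
        linarith
      · rw [hgt]
        have := mz t
        linarith
    · intro t
      rw [ContinuousMap.sub_apply, hgt]
      have := mz t
      linarith
    · filter_upwards [hp1.2.2, hp2.2.2] with t a1 a3
      have a2 := e1 t
      have a4 := e2 t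
      rw [ContinuousMap.sub_apply] at a1 a3
      rw [ContinuousMap.sub_apply, hgt]
      have : max (g1 t) (g2 t) < z t := max_lt (by linarith) (by linarith)
      linarith

lemma pick (ht0 : Filter.NeBot (𝓝[≠] t0)) {gg : GoodGroup X t0} {f : C(X, ℝ)}
    (hf : PosM gg f) (hft0 : f t0 = 0) {h : X → ℝ} (hh : MemLfNZ gg f h) (hC : PropC gg f h)
    {K : Set X} (hK : IsCompact K) (hKU : K ⊆ Uf f) :
    ∃ z, SS gg f h z ∧ PosM gg z ∧ ∀ t ∈ K, z t = h t := by
  obtain ⟨z0, hz0, hne, hle⟩ := hh.2.2.2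
  have p0 : PosM gg z0 := ((mem_M _ _).1 hz0.1).resolve_left hne
  have pz : PosM gg ((1/2 : ℝ) • z0) := by
    refine ⟨half_mem gg p0.1, fun t => ?_, ?_⟩
    · have := p0.2.1 t
      simp [this]
    · filter_upwards [p0.2.2] with t ht
      simp [ht]
  have sz : SS gg f h ((1/2 : ℝ) • z0) := by
    refine ⟨Nf_of_le hf hz0 pz fun t => ?_, fun t ht => ?_, ?_⟩
    · have := p0.2.1 t
      simp; linarith
    · have := p0.2.1 t
      have := hle t ht
      simp; linarith
    · filter_upwards [p0.2.2] with t ht hu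
      have := hle t hu
      simp; linarith
  have : ∃ z, SS gg f h z ∧ PosM gg z ∧ ∀ t ∈ K ∩ Uf f, z t = h t := by
    refine hK.induction_on (p := fun K => ∃ z, SS gg f h z ∧ PosM gg z ∧
      ∀ t ∈ K ∩ Uf f, z t = h t) ⟨_, sz, pz, by simp⟩ ?_ ?_ ?_
    · rintro s t hst ⟨z, a, b, c⟩
      exact ⟨z, a, b, fun x hx => c x ⟨hst hx.1, hx.2⟩⟩
    · rintro s t ⟨z, a, b, c⟩ ⟨z', a', b', c'⟩
      refine ⟨z ⊔ z', a.sup hf a', b.sup b'.1, ?_⟩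
      rintro x ⟨hx | hx, hu⟩
      · have := c x ⟨hx, hu⟩
        have := a'.2.1 x hu
        simp
        rw [max_eq_left] <;> linarith
      · have := c' x ⟨hx, hu⟩
        have := a.2.1 x hu
        simp
        rw [max_eq_right] <;> linarith
    · intro x hx
      have hxt : x ≠ t0 := by
        rintro rfl
        exact hKU hx hft0
      obtain ⟨z, h1, h2, ⟨W, hW, hxW, h3⟩, h4⟩ := hC x (hKU hx) hxt
      have s1 : SS gg f h z := ⟨h1, h2, (ev_iff2 _ _).1 h4⟩
      refine ⟨W, mem_nhdsWithin_of_mem_nhds (hW.mem_nhds hxW), ((1/2 : ℝ) • z0) ⊔ z, sz.sup hf s1,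
        pz.sup (M_G h1.1), ?_⟩
      rintro t ht
      have e1 := h3 t ht
      have e2 := sz.2.1 t ht.2
      rw [ContinuousMap.sup_apply, max_eq_right] <;> linarith
  obtain ⟨z, a, b, c⟩ := this
  exact ⟨z, a, b, fun t ht => c t ⟨ht, hKU ht⟩⟩

lemma one_memG (gg : GoodGroup X t0) (q : ℚ) (hq : 0 ≤ q) :
    ContinuousMap.const X (q : ℝ) ∈ gg.G := const_mem gg q hq

lemma mem_D {gg : GoodGroup X t0} {f : C(X, ℝ)} (hf : PosM gg f) (hft0 : f t0 = 0)
    (g : C(X, ℝ)) : g ∈ Df gg f ↔ g ∈ Nf gg f ∧ ∀ t, g t ≤ 1 := by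
  constructor
  · rintro ⟨h1, h2⟩
    exact ⟨h1, fun t => by simpa using le_of_leM h2 t⟩
  · rintro ⟨h1, h2⟩
    refine ⟨h1, leM_of_pos ⟨gg.G.sub_mem ?_ (M_G h1.1), fun t => by simp [h2], ?_⟩⟩
    · convert const_mem gg 1 (by norm_num)
      ext t
      simp
    · have : g t0 = 0 := Nf_zero hf h1 (by simp [Uf, hft0])
      have h3 : ∀ᶠ t in 𝓝 t0, g t < 1 :=
        (g.continuous.continuousAt).eventually_lt continuousAt_const (by simp [this])
      filter_upwards [nhdsWithin_le_nhds h3] with t ht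
      simp [ht]

lemma mem_nD {gg : GoodGroup X t0} {f : C(X, ℝ)} (hf : PosM gg f) (hft0 : f t0 = 0)
    (n : ℕ) (hn : 1 ≤ n) (g : C(X, ℝ)) :
    g ∈ nFold n (Df gg f) ↔ g ∈ Nf gg f ∧ ∀ t, g t ≤ n := by
  constructor
  · rintro ⟨y, hy, rfl⟩
    constructor
    · exact Finset.sum_induction _ (· ∈ Nf gg f) (fun a b => Nf_add hf) (zero_Nf hf)
        (fun i _ => (hy i).1)
    · intro t
      rw [ContinuousMap.sum_apply]
      calc ∑ i, y i t ≤ ∑ i : Fin n, (1 : ℝ) :=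
            Finset.sum_le_sum fun i _ => ((mem_D hf hft0 _).1 (hy i)).2 t
        _ = n := by simp
  · rintro ⟨h1, h2⟩
    have hn' : (1 : ℝ) ≤ n := by exact_mod_cast hn
    have hn0 : (0 : ℝ) < n := by linarith
    refine ⟨fun _ => ((n : ℝ)⁻¹) • g, fun _ => (mem_D hf hft0 _).2 ⟨?_, fun t => ?_⟩, ?_⟩
    · rcases (mem_M _ _).1 h1.1 with rfl | hp
      · simpa using zero_Nf hf
      · refine Nf_of_le hf h1 ⟨?_, fun t => ?_, ?_⟩ fun t => ?_
        · have := gg.rat_smul_mem ((n : ℚ)⁻¹) g hp.1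
          push_cast at this
          exact this
        · have := hp.2.1 t
          simp; positivity
        · filter_upwards [hp.2.2] with t ht
          simp; positivity
        · have := hp.2.1 t
          simp
          exact mul_le_of_le_one_left this (inv_le_one_of_one_le₀ hn')
    · have := h2 t
      simp
      rw [inv_mul_le_iff₀ hn0]
      simpa
    · ext t
      simp
      field_simp

variable [CompactSpace X] [TopologicalSpace.MetrizableSpace X] [Infinite X]

/-- `I_f(h) + I_f(n - h) = n·D_f`; in particular `I_f(h)` is a
complemented interval in `N_f`. -/
theorem statement_12 (ht0 : Filter.NeBot (𝓝[≠] t0)) (gg : GoodGroup X t0)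
    (f : C(X, ℝ)) (hfM : f ∈ Mset gg) (hf : f ≠ 0) (hff0 : leM gg f gg.f0)
    (n : ℕ) (hn : 1 ≤ n) (h : X → ℝ)
    (hh : MemLfNZ gg f h) (hhC : PropC gg f h)
    (hnh : MemLfNZ gg f (fun t => (n : ℝ) - h t))
    (hnhC : PropC gg f (fun t => (n : ℝ) - h t))
    (ε : ℝ) (hε : 0 < ε) (hεb : ∀ t ∈ Uf f, ε ≤ (n : ℝ) - h t) :
    Iset gg f h + Iset gg f (fun t => (n : ℝ) - h t) = nFold n (Df gg f) ∧
    IsCompInterval gg f (Iset gg f h) := by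
  have hfP : PosM gg f := ((mem_M _ _).1 hfM).resolve_left hf
  have hft0 : f t0 = 0 := by
    have := le_of_leM hff0 t0
    rw [gg.f0_zero] at this
    exact le_antisymm this (hfP.2.1 t0)
  have main : Iset gg f h + Iset gg f (fun t => (n : ℝ) - h t) = nFold n (Df gg f) := by
    ext g
    rw [mem_nD hfP hft0 n hn]
    constructor
    · rintro ⟨x, hx, y, hy, rfl⟩
      have hN := Nf_add hfP (I_sub hfP hx) (I_sub hfP hy)
      refine ⟨hN, fun t => ?_⟩
      by_cases ht : t ∈ Uf f
      · have := I_le ht0 hh.2.2.1 hx t ht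
        have := I_le ht0 hnh.2.2.1 hy t ht
        simp at *
        linarith
      · have := Nf_zero hfP hN ht
        simp only at this ⊢
        rw [this]
        positivity
    · rintro ⟨hg, hgn⟩
      rcases (mem_M _ _).1 hg.1 with rfl | hgP
      · exact ⟨0, Or.inl rfl, 0, Or.inl rfl, by simp⟩
      obtain ⟨q, hq0, hqε⟩ := exists_rat_btwn hε
      have hq0' : 0 ≤ q := by exact_mod_cast hq0.le
      set K : Set X := {t | (q : ℝ) ≤ g t} with hKdef
      have hKc : IsClosed K := isClosed_le continuous_const g.continuous
      have hKU : K ⊆ Uf f := by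
        intro t ht
        by_contra hu
        have := Nf_zero hfP hg hu
        simp only [hKdef, mem_setOf_eq] at ht
        linarith
      obtain ⟨z, sz, pz, ez⟩ := pick ht0 hfP hft0 hh hhC hKc.isCompact hKU
      obtain ⟨w, sw, pw, ew⟩ := pick ht0 hfP hft0 hnh hnhC hKc.isCompact hKU
      have hcP : PosM gg (ContinuousMap.const X (q : ℝ)) :=
        ⟨const_mem gg q hq0', fun t => by simpa using hq0.le, by simp [hq0]⟩
      have sc : SS gg f (fun t => (n : ℝ) - h t) (g ⊓ ContinuousMap.const X (q : ℝ)) := by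
        refine ⟨Nf_of_le hfP hg (hgP.inf hcP) fun t => by simp, fun t ht => ?_,
          Filter.Eventually.of_forall fun t ht => ?_⟩
        · have := hεb t ht
          exact (min_le_right _ _).trans (by simp; linarith)
        · have := hεb t ht
          exact (min_le_right _ _).trans_lt (by simp; linarith)
      have sw' := sw.sup hfP sc
      set w' := w ⊔ (g ⊓ ContinuousMap.const X (q : ℝ)) with hw'
      have w1 : ∀ t, w t ≤ w' t := fun t => by simp [hw']
      have w2 : ∀ t, t ∉ K → g t ≤ w' t := fun t ht => by
        have : g t < q := by simpa [hKdef] using ht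
        simp [hw', this.le]
      have ht0K : t0 ∉ K := fun hk => hKU hk hft0
      obtain ⟨U, hU, htU, -, r, hrG, hr, hrU, hrK⟩ := gg.urysohn {t0} Kᶜ isClosed_singleton
        hKc.isOpen_compl (by simpa using ht0K) n (by positivity)
      have mP := hgP.inf pz
      set m := g ⊓ z with hm
      have mg : ∀ t, m t ≤ g t := fun t => by simp [hm]
      have mz : ∀ t, m t ≤ z t := fun t => by simp [hm]
      have nG : ContinuousMap.const X (n : ℝ) ∈ gg.G := by
        simpa using const_mem gg (n : ℚ) (by positivity)
      set x := m ⊓ ((1/2 : ℝ) • m + (ContinuousMap.const X (n : ℝ) - r)) with hx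
      have xt : ∀ t, x t = min (m t) (m t / 2 + (n - r t)) := fun t => by
        simp [hx]; ring_nf
      have xG : x ∈ gg.G := gg.inf_mem _ _ mP.1
        (gg.G.add_mem (half_mem gg mP.1) (gg.G.sub_mem nG hrG))
      have xm : ∀ t, x t ≤ m t := fun t => by rw [xt]; exact min_le_left _ _
      have xK : ∀ t ∈ K, x t = m t := fun t ht => by
        rw [xt, min_eq_left]
        have := hrK t (by simpa using ht)
        have := mg t
        have := hgn t
        have := mP.2.1 t
        linarith
      have x0 : ∀ t, 0 ≤ x t := fun t => by
        rw [xt]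
        have a1 := (hr t).2
        have a2 := mP.2.1 t
        push_cast at a1
        exact le_min a2 (by linarith)
      have xU : ∀ t ∈ U, x t = m t / 2 := fun t ht => by
        have a1 := hrU t ht
        have a2 := mP.2.1 t
        push_cast at a1
        rw [xt, min_eq_right] <;> linarith
      have evU : ∀ᶠ t in 𝓝[≠] t0, t ∈ U ∧ t ∉ K := by
        refine nhdsWithin_le_nhds (Filter.Eventually.and ?_ ?_)
        · exact hU.mem_nhds (htU rfl)
        · exact hKc.isOpen_compl.mem_nhds ht0K
      have xP : PosM gg x := by
        refine ⟨xG, x0, ?_⟩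
        filter_upwards [evU, mP.2.2] with t a b
        rw [xU t a.1]
        linarith
      have yP : PosM gg (g - x) := by
        refine ⟨gg.G.sub_mem hgP.1 xG, fun t => ?_, ?_⟩
        · have := xm t
          have := mg t
          simp; linarith
        · filter_upwards [evU, mP.2.2] with t a b
          have := mg t
          rw [ContinuousMap.sub_apply, xU t a.1]
          linarith
      refine ⟨x, (mem_I ht0 _ _ _ _).2 (Or.inr ⟨?_, z, sz, gg.G.sub_mem pz.1 xG, ?_, ?_⟩), g - x,
        (mem_I ht0 _ _ _ _).2 (Or.inr ⟨?_, w', sw', gg.G.sub_mem (M_G sw'.1.1) yP.1, ?_, ?_⟩),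
        by simp⟩
      · exact Nf_of_le hfP hg xP fun t => (xm t).trans (mg t)
      · intro t
        have := xm t
        have := mz t
        simp; linarith
      · filter_upwards [evU, mP.2.2] with t a b
        have := mz t
        rw [ContinuousMap.sub_apply, xU t a.1]
        linarith
      · exact Nf_of_le hfP hg yP fun t => by simp [x0]
      · intro t
        rw [ContinuousMap.sub_apply, ContinuousMap.sub_apply]
        by_cases ht : t ∈ K
        · rw [xK t ht]
          have b1 := ez t ht
          have b2 : w t = n - h t := ew t ht
          have b3 := w1 t
          have b4 := hgn t
          have b5 := pw.2.1 t
          have b6 : m t = min (g t) (z t) := rfl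
          rcases min_choice (g t) (z t) with b7 | b7 <;> rw [b6, b7] <;> linarith
        · have := w2 t ht
          have := x0 t
          linarith
      · filter_upwards [evU, mP.2.2] with t a b
        have := w2 t a.2
        rw [ContinuousMap.sub_apply, ContinuousMap.sub_apply, xU t a.1]
        linarith
  exact ⟨main, I_interval ht0 hfP h, _, I_interval ht0 hfP _, n, hn, main⟩
end

section
/- Let (B_n)_{n≥0} be an increasing sequence of closed *-subalgebras of D with 1 ∈ B_0, and let B be the closure of the union of the B_n. Let p, q ∈ D be projections with p + q = 1, and let (p_n)_{n≥0} and (q_n)_{n≥0} be sequences of projections in D such that, for every n: p_n ∈ B_n, q_n ∈ B_n, p_n + q_n ∈ B_0, p_n ≤ p and q_n ≤ q. If there exists δ > 0 such that dist(p_n, B_{n−1}) ≥ δ for all n ≥ 1, then p ∉ B and q ∉ B. -/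
/-- if `(p_n)` keeps a fixed distance `δ` from the previous algebra
`B_{n-1}`, then the strict limits `p` and `q = 1 - p` do not lie in the closure
`B` of the union of the `B_n`. -/
theorem statement_13 {D : Type*} [NormedRing D] [StarRing D] [CStarRing D]
    [NormedAlgebra ℂ D] [StarModule ℂ D] [CompleteSpace D]
    (B : ℕ → StarSubalgebra ℂ D)
    (hmono : ∀ n, B n ≤ B (n + 1))
    (hclosed : ∀ n, IsClosed (B n : Set D))
    (hone : (1 : D) ∈ B 0)
    (p q : D)
    (hp : IsSelfAdjoint p ∧ IsIdempotentElem p)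
    (hq : IsSelfAdjoint q ∧ IsIdempotentElem q)
    (hpq : p + q = 1)
    (pn qn : ℕ → D)
    (hpn : ∀ n, IsSelfAdjoint (pn n) ∧ IsIdempotentElem (pn n))
    (hqn : ∀ n, IsSelfAdjoint (qn n) ∧ IsIdempotentElem (qn n))
    (hpnB : ∀ n, pn n ∈ B n) (hqnB : ∀ n, qn n ∈ B n)
    (hsum : ∀ n, pn n + qn n ∈ B 0)
    (hple : ∀ n, pn n * p = pn n) (hqle : ∀ n, qn n * q = qn n)
    (δ : ℝ) (hδ : 0 < δ)
    (hdist : ∀ n, 1 ≤ n → δ ≤ Metric.infDist (pn n) (B (n - 1) : Set D)) :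
    p ∉ closure (⋃ n, (B n : Set D)) ∧ q ∉ closure (⋃ n, (B n : Set D)) := by
  have hnorm : ∀ e : D, IsSelfAdjoint e ∧ IsIdempotentElem e → ‖e‖ ≤ 1 := by
    rintro e ⟨h1, h2⟩
    have h := CStarRing.norm_star_mul_self (x := e)
    rw [h1.star_eq, h2.eq] at h
    nlinarith [norm_nonneg e]
  have hm : Monotone B := monotone_nat_of_le_succ hmono
  have key : ∀ m, ∀ b ∈ B m, δ / 2 ≤ ‖p - b‖ := by
    intro m b hb
    have h1 : qn (m+1) * p = 0 := by
      have : p = 1 - q := eq_sub_of_add_eq hpq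
      rw [this, mul_sub, mul_one, hqle, sub_self]
    have h2 : pn (m+1) = (pn (m+1) + qn (m+1)) * p := by
      rw [add_mul, h1, hple, add_zero]
    have h3 : (pn (m+1) + qn (m+1)) * b ∈ B m :=
      mul_mem (hm (Nat.zero_le m) (hsum (m+1))) hb
    have h4 := hdist (m+1) (by omega)
    have h5 := Metric.infDist_le_dist_of_mem (x := pn (m+1)) (s := (B m : Set D)) h3
    have h6 : dist (pn (m+1)) ((pn (m+1) + qn (m+1)) * b) ≤ 2 * ‖p - b‖ := by
      rw [dist_eq_norm]
      have h7 : pn (m+1) - (pn (m+1) + qn (m+1)) * b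
          = (pn (m+1) + qn (m+1)) * (p - b) := by
        rw [mul_sub, ← h2]
      rw [h7]
      refine (norm_mul_le _ _).trans ?_
      gcongr
      have := norm_add_le (pn (m+1)) (qn (m+1))
      linarith [hnorm _ (hpn (m+1)), hnorm _ (hqn (m+1))]
    simp only [Nat.add_sub_cancel] at h4
    linarith
  constructor
  · intro h
    obtain ⟨b, hb, hd⟩ := Metric.mem_closure_iff.1 h (δ / 2) (by positivity)
    obtain ⟨m, hb⟩ := Set.mem_iUnion.1 hb
    rw [dist_eq_norm] at hd
    linarith [key m b hb]
  · intro h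
    obtain ⟨b, hb, hd⟩ := Metric.mem_closure_iff.1 h (δ / 2) (by positivity)
    obtain ⟨m, hb⟩ := Set.mem_iUnion.1 hb
    rw [dist_eq_norm] at hd
    have h1 := key m (1 - b) (sub_mem (one_mem _) hb)
    have h2 : p - (1 - b) = -(q - b) := by rw [← hpq]; abel
    rw [h2, norm_neg] at h1
    linarith
end
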